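/- Let (μ,K) and (μ̄,K̄) be two admissible pairs with the same finite input alphabet X and finite output alphabet Y, and let Φ : [0,∞) → ℝ be convex with homogeneous Φ-entropy. Assume that μ̄(x)K̄(y|x) > 0 implies μ(x)K(y|x) > 0 for all (x,y), and set A = max over pairs (x,y) with μ(x)K(y|x) > 0 of μ̄(x)K̄(y|x)/(μ(x)K(y|x)), and a = min_{x ∈ X} μ̄(x)/μ(x). Then η_Φ(μ,K) ≤ 1 − (a/A)·(1 − η_Φ(μ̄,K̄)). -/

import Mathlib

open Finset

noncomputable section

namespace SDPI

variable {X Y : Type} [Fintype X] [Fintype Y]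

def IsDist (μ : X → ℝ) : Prop := (∀ x, 0 ≤ μ x) ∧ ∑ x, μ x = 1

def IsPosDist (μ : X → ℝ) : Prop := (∀ x, 0 < μ x) ∧ ∑ x, μ x = 1

def IsChannel (K : X → Y → ℝ) : Prop :=
  (∀ x y, 0 ≤ K x y) ∧ ∀ x, ∑ y, K x y = 1

def push (μ : X → ℝ) (K : X → Y → ℝ) : Y → ℝ := fun y => ∑ x, μ x * K x y

def fDiv (Φ : ℝ → ℝ) (ν μ : X → ℝ) : ℝ := (∑ x, μ x * Φ (ν x / μ x)) - Φ 1

def eta (Φ : ℝ → ℝ) (μ : X → ℝ) (K : X → Y → ℝ) : ℝ :=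
  sSup { r | ∃ ν : X → ℝ, IsDist ν ∧ ν ≠ μ ∧
    r = fDiv Φ (push ν K) (push μ K) / fDiv Φ ν μ }

def etaSup (Φ : ℝ → ℝ) (K : X → Y → ℝ) : ℝ :=
  sSup { r | ∃ μ : X → ℝ, IsPosDist μ ∧ r = eta Φ μ K }

def maxCorr (μ : X → ℝ) (K : X → Y → ℝ) : ℝ :=
  sSup { r | ∃ (f : X → ℝ) (g : Y → ℝ),
    (∑ x, μ x * f x) = 0 ∧ (∑ y, push μ K y * g y) = 0 ∧
    (∑ x, μ x * (f x) ^ 2) = 1 ∧ (∑ y, push μ K y * (g y) ^ 2) = 1 ∧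
    r = ∑ x, ∑ y, μ x * K x y * (f x * g y) }

def adjoint (μ : X → ℝ) (K : X → Y → ℝ) : Y → X → ℝ :=
  fun y x => K x y * μ x / push μ K y

def Ent (Φ : ℝ → ℝ) (μ : X → ℝ) (f : X → ℝ) : ℝ :=
  (∑ x, μ x * Φ (f x)) - Φ (∑ x, μ x * f x)

def Var (μ : X → ℝ) (f : X → ℝ) : ℝ :=
  ∑ x, μ x * (f x - ∑ x', μ x' * f x') ^ 2

def condExp (μ : X → ℝ) (K : X → Y → ℝ) (f : X → ℝ) : Y → ℝ :=
  fun y => (∑ x, μ x * K x y * f x) / push μ K y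

def calE (μ : X → ℝ) (K : X → Y → ℝ) (f g : X → ℝ) : ℝ :=
  ∑ x, ∑ y, μ x * K x y *
    ((f x - condExp μ K f y) * (g x - condExp μ K g y))

def dirichlet (μ : X → ℝ) (M : X → X → ℝ) (f g : X → ℝ) : ℝ :=
  (1 / 2) * ∑ x, ∑ x', μ x * M x x' * ((f x - f x') * (g x - g x'))

def Homogeneous (Φ : ℝ → ℝ) : Prop :=
  ∃ κ : ℝ → ℝ, (∀ c : ℝ, 0 < c → 0 < κ c) ∧
    ∀ (c : ℝ), 0 < c → ∀ (Z : Type) [Fintype Z], ∀ (μ : Z → ℝ),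
      IsDist μ → ∀ f : Z → ℝ, (∀ z, 0 ≤ f z) →
        Ent Φ μ (fun z => c * f z) = κ c * Ent Φ μ f

def Subadditive (Φ : ℝ → ℝ) : Prop :=
  ∀ (n : ℕ) (Z : Fin n → Type) [∀ i, Fintype (Z i)],
    ∀ (μ : ∀ i, Z i → ℝ), (∀ i, IsDist (μ i)) →
    ∀ f : (∀ i, Z i) → ℝ, (∀ z, 0 ≤ f z) →
      Ent Φ (fun z : ∀ i, Z i => ∏ i, μ i (z i)) f ≤
        ∑ i : Fin n,
          ((∑ z : ∀ j, Z j, (∏ j, μ j (z j)) * Φ (f z)) -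
            ∑ z : ∀ j, Z j, (∏ j, μ j (z j)) *
              Φ (∑ w : Z i, μ i w * f (Function.update z i w)))


/-- A convex function on `[0, ∞)` has a supporting line at every positive point. -/
theorem exists_supporting_line {Φ : ℝ → ℝ} (hΦ : ConvexOn ℝ (Set.Ici 0) Φ) {c : ℝ} (hc : 0 < c) :
    ∃ s : ℝ, ∀ t, 0 ≤ t → Φ c + s * (t - c) ≤ Φ t := by
  have hci : c ∈ interior (Set.Ici (0 : ℝ)) := by simpa using hc
  refine ⟨derivWithin Φ (Set.Ioi c) c, fun t ht => ?_⟩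
  rcases lt_trichotomy t c with h | rfl | h
  · have h1 := (hΦ.slope_le_leftDeriv_of_mem_interior ht hci h).trans
      (hΦ.leftDeriv_le_rightDeriv_of_mem_interior hci)
    rw [slope_def_field, div_le_iff₀ (sub_pos.2 h)] at h1
    linarith
  · simp
  · have h1 := hΦ.rightDeriv_le_slope_of_mem_interior hci ht h
    rw [slope_def_field, le_div_iff₀ (sub_pos.2 h)] at h1
    linarith

/-- The Jensen gap of `f` with respect to a weight `w` that need not be normalized. -/
def jensenGap (Φ : ℝ → ℝ) (w f : X → ℝ) : ℝ :=
  (∑ x, w x * Φ (f x)) - (∑ x, w x) * Φ ((∑ x, w x * f x) / ∑ x, w x)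

theorem jensenGap_le_mul {Φ : ℝ → ℝ} (hΦ : ConvexOn ℝ (Set.Ici 0) Φ) {w w' f : X → ℝ}
    {A : ℝ} (hw : ∀ x, 0 ≤ w x) (hw' : ∀ x, 0 ≤ w' x) (hf : ∀ x, 0 ≤ f x)
    (hpos : 0 < ∑ x, w x) (hle : ∀ x, w' x ≤ A * w x) :
    jensenGap Φ w' f ≤ A * jensenGap Φ w f := by
  have hwf : ∀ x, 0 ≤ w x * f x := fun x => mul_nonneg (hw x) (hf x)
  have hwf' : ∀ x, 0 ≤ w' x * f x := fun x => mul_nonneg (hw' x) (hf x)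
  have gap_eq_zero : ∀ v : X → ℝ, (∀ x, v x * f x = 0) → jensenGap Φ v f = 0 := by
    intro v hv
    have h1 : ∀ x, v x * Φ (f x) = v x * Φ 0 := by
      intro x
      rcases mul_eq_zero.1 (hv x) with h | h <;> simp [h]
    simp [jensenGap, h1, hv, ← Finset.sum_mul]
  rcases (div_nonneg (Finset.sum_nonneg fun x _ => hwf x) hpos.le).eq_or_lt with hc | hc
  · have h0 : ∀ x, w x * f x = 0 := by
      rw [eq_comm, div_eq_zero_iff, or_iff_left hpos.ne'] at hc
      exact fun x => (Finset.sum_eq_zero_iff_of_nonneg fun x _ => hwf x).1 hc x (Finset.mem_univ x)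
    have h0' : ∀ x, w' x * f x = 0 := by
      intro x
      have h1 := mul_le_mul_of_nonneg_right (hle x) (hf x)
      rw [mul_assoc, h0 x, mul_zero] at h1
      exact le_antisymm h1 (hwf' x)
    simp [gap_eq_zero w h0, gap_eq_zero w' h0']
  · obtain ⟨s, hs⟩ := exists_supporting_line hΦ hc
    set c := (∑ x, w x * f x) / ∑ x, w x with hcdef
    have hexp : ∀ v : X → ℝ, ∑ x, v x * (Φ (f x) - (Φ c + s * (f x - c))) =
        (∑ x, v x * Φ (f x)) - (∑ x, v x) * Φ c -
          s * ((∑ x, v x * f x) - (∑ x, v x) * c) := by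
      intro v
      simp only [Finset.sum_mul, Finset.mul_sum, ← Finset.sum_sub_distrib]
      exact Finset.sum_congr rfl fun x _ => by ring
    have hsum : ∑ x, w' x * (Φ (f x) - (Φ c + s * (f x - c))) ≤
        A * ∑ x, w x * (Φ (f x) - (Φ c + s * (f x - c))) := by
      rw [Finset.mul_sum]
      refine Finset.sum_le_sum fun x _ => ?_
      rw [← mul_assoc]
      exact mul_le_mul_of_nonneg_right (hle x) (sub_nonneg.2 (hs _ (hf x)))
    have hw0 : (∑ x, w x * f x) - (∑ x, w x) * c = 0 := by
      rw [hcdef, mul_div_cancel₀ _ hpos.ne', sub_self]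
    rw [hexp, hexp, hw0, mul_zero, sub_zero] at hsum
    have hW' : 0 ≤ ∑ x, w' x := Finset.sum_nonneg fun x _ => hw' x
    have hc' := hs ((∑ x, w' x * f x) / ∑ x, w' x)
      (div_nonneg (Finset.sum_nonneg fun x _ => hwf' x) hW')
    have hcancel : (∑ x, w' x) * ((∑ x, w' x * f x) / ∑ x, w' x) = ∑ x, w' x * f x := by
      rcases hW'.eq_or_lt with h | h
      · have h0 : ∀ x, w' x = 0 := by
          rw [eq_comm, Finset.sum_eq_zero_iff_of_nonneg fun x _ => hw' x] at h
          simpa using h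
        simp [h0]
      · exact mul_div_cancel₀ _ h.ne'
    have h2 := mul_le_mul_of_nonneg_left hc' hW'
    have h3 : (∑ x, w' x) * (Φ c + s * ((∑ x, w' x * f x) / (∑ x, w' x) - c)) =
        (∑ x, w' x) * Φ c + s * ((∑ x, w' x * f x) - (∑ x, w' x) * c) := by
      linear_combination s * hcancel
    unfold jensenGap
    linarith

theorem jensenGap_nonneg {Φ : ℝ → ℝ} (hΦ : ConvexOn ℝ (Set.Ici 0) Φ) {w f : X → ℝ}
    (hw : ∀ x, 0 ≤ w x) (hf : ∀ x, 0 ≤ f x) (hpos : 0 < ∑ x, w x) :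
    0 ≤ jensenGap Φ w f := by
  have h := jensenGap_le_mul hΦ (w' := 0) (A := 1) hw (by simp) hf hpos (by simpa using hw)
  simpa [jensenGap] using h

theorem jensenGap_eq_Ent (Φ : ℝ → ℝ) {μ f : X → ℝ} (hμ : ∑ x, μ x = 1) :
    jensenGap Φ μ f = Ent Φ μ f := by
  simp [jensenGap, Ent, hμ]

theorem Ent_nonneg {Φ : ℝ → ℝ} (hΦ : ConvexOn ℝ (Set.Ici 0) Φ) {μ f : X → ℝ}
    (hμ : IsDist μ) (hf : ∀ x, 0 ≤ f x) : 0 ≤ Ent Φ μ f := by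
  rw [← jensenGap_eq_Ent Φ hμ.2]
  exact jensenGap_nonneg hΦ hμ.1 hf (by simp [hμ.2])

theorem IsPosDist.isDist {μ : X → ℝ} (hμ : IsPosDist μ) : IsDist μ :=
  ⟨fun x => (hμ.1 x).le, hμ.2⟩

theorem sum_push {μ : X → ℝ} {K : X → Y → ℝ} (hK : IsChannel K) :
    ∑ y, push μ K y = ∑ x, μ x := by
  unfold push
  rw [Finset.sum_comm]
  simp [← Finset.mul_sum, hK.2]

theorem sum_push_mul_condExp {μ : X → ℝ} {K : X → Y → ℝ} (hK : IsChannel K)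
    (hadm : ∀ y, 0 < push μ K y) (f : X → ℝ) :
    ∑ y, push μ K y * condExp μ K f y = ∑ x, μ x * f x := by
  have h : ∀ y, push μ K y * condExp μ K f y = ∑ x, μ x * K x y * f x := fun y =>
    mul_div_cancel₀ _ (hadm y).ne'
  simp only [h]
  rw [Finset.sum_comm]
  refine Finset.sum_congr rfl fun x _ => ?_
  rw [← Finset.sum_mul, ← Finset.mul_sum, hK.2, mul_one]

/-- The chain rule for the `Φ`-entropy. -/
theorem sum_jensenGap_eq_Ent_sub_Ent (Φ : ℝ → ℝ) {μ : X → ℝ} {K : X → Y → ℝ}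
    (hK : IsChannel K) (hadm : ∀ y, 0 < push μ K y) (f : X → ℝ) :
    ∑ y, jensenGap Φ (fun x => μ x * K x y) f =
      Ent Φ μ f - Ent Φ (push μ K) (condExp μ K f) := by
  have h1 : ∑ y, ∑ x, μ x * K x y * Φ (f x) = ∑ x, μ x * Φ (f x) := by
    rw [Finset.sum_comm]
    refine Finset.sum_congr rfl fun x _ => ?_
    rw [← Finset.sum_mul, ← Finset.mul_sum, hK.2, mul_one]
  unfold Ent
  rw [sum_push_mul_condExp hK hadm, sub_sub_sub_cancel_right, ← h1, ← Finset.sum_sub_distrib]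
  rfl

theorem Ent_condExp_le {Φ : ℝ → ℝ} (hΦ : ConvexOn ℝ (Set.Ici 0) Φ) {μ : X → ℝ}
    {K : X → Y → ℝ} (hμ : IsDist μ) (hK : IsChannel K) (hadm : ∀ y, 0 < push μ K y)
    {f : X → ℝ} (hf : ∀ x, 0 ≤ f x) :
    Ent Φ (push μ K) (condExp μ K f) ≤ Ent Φ μ f := by
  rw [← sub_nonneg, ← sum_jensenGap_eq_Ent_sub_Ent Φ hK hadm]
  exact Finset.sum_nonneg fun y _ =>
    jensenGap_nonneg hΦ (fun x => mul_nonneg (hμ.1 x) (hK.1 x y)) hf (hadm y)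

theorem fDiv_eq_Ent (Φ : ℝ → ℝ) {ν μ : X → ℝ} (hμ : ∀ x, 0 < μ x) (hν : ∑ x, ν x = 1) :
    fDiv Φ ν μ = Ent Φ μ (fun x => ν x / μ x) := by
  have h : ∀ x, μ x * (ν x / μ x) = ν x := fun x => mul_div_cancel₀ _ (hμ x).ne'
  simp [fDiv, Ent, h, hν]

theorem fDiv_push_eq_Ent (Φ : ℝ → ℝ) {ν μ : X → ℝ} {K : X → Y → ℝ} (hμ : ∀ x, 0 < μ x)
    (hK : IsChannel K) (hadm : ∀ y, 0 < push μ K y) (hν : ∑ x, ν x = 1) :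
    fDiv Φ (push ν K) (push μ K) =
      Ent Φ (push μ K) (condExp μ K fun x => ν x / μ x) := by
  rw [fDiv_eq_Ent Φ hadm ((sum_push hK).trans hν)]
  congr 1
  ext y
  unfold condExp
  congr 1
  refine Finset.sum_congr rfl fun x _ => ?_
  rw [mul_right_comm, mul_div_cancel₀ _ (hμ x).ne']

section Eta

variable {Φ : ℝ → ℝ} {μ : X → ℝ} {K : X → Y → ℝ}

theorem fDiv_nonneg (hΦ : ConvexOn ℝ (Set.Ici 0) Φ) (hμ : IsPosDist μ) {ν : X → ℝ}
    (hν : IsDist ν) : 0 ≤ fDiv Φ ν μ := by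
  rw [fDiv_eq_Ent Φ hμ.1 hν.2]
  exact Ent_nonneg hΦ hμ.isDist fun x => div_nonneg (hν.1 x) (hμ.1 x).le

theorem fDiv_push_nonneg (hΦ : ConvexOn ℝ (Set.Ici 0) Φ) (hμ : IsPosDist μ)
    (hK : IsChannel K) (hadm : ∀ y, 0 < push μ K y) {ν : X → ℝ} (hν : IsDist ν) :
    0 ≤ fDiv Φ (push ν K) (push μ K) :=
  fDiv_nonneg hΦ ⟨hadm, (sum_push hK).trans hμ.2⟩
    ⟨fun y => Finset.sum_nonneg fun x _ => mul_nonneg (hν.1 x) (hK.1 x y),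
      (sum_push hK).trans hν.2⟩

/-- The data processing inequality. -/
theorem fDiv_push_le (hΦ : ConvexOn ℝ (Set.Ici 0) Φ) (hμ : IsPosDist μ)
    (hK : IsChannel K) (hadm : ∀ y, 0 < push μ K y) {ν : X → ℝ} (hν : IsDist ν) :
    fDiv Φ (push ν K) (push μ K) ≤ fDiv Φ ν μ := by
  rw [fDiv_push_eq_Ent Φ hμ.1 hK hadm hν.2, fDiv_eq_Ent Φ hμ.1 hν.2]
  exact Ent_condExp_le hΦ hμ.isDist hK hadm fun x => div_nonneg (hν.1 x) (hμ.1 x).le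

theorem fDiv_ratio_le_one (hΦ : ConvexOn ℝ (Set.Ici 0) Φ) (hμ : IsPosDist μ)
    (hK : IsChannel K) (hadm : ∀ y, 0 < push μ K y) {ν : X → ℝ} (hν : IsDist ν) :
    fDiv Φ (push ν K) (push μ K) / fDiv Φ ν μ ≤ 1 :=
  div_le_one_of_le₀ (fDiv_push_le hΦ hμ hK hadm hν) (fDiv_nonneg hΦ hμ hν)

theorem eta_nonneg (hΦ : ConvexOn ℝ (Set.Ici 0) Φ) (hμ : IsPosDist μ)
    (hK : IsChannel K) (hadm : ∀ y, 0 < push μ K y) : 0 ≤ eta Φ μ K := by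
  refine Real.sSup_nonneg ?_
  rintro r ⟨ν, hν, -, rfl⟩
  exact div_nonneg (fDiv_push_nonneg hΦ hμ hK hadm hν) (fDiv_nonneg hΦ hμ hν)

theorem eta_le_one (hΦ : ConvexOn ℝ (Set.Ici 0) Φ) (hμ : IsPosDist μ)
    (hK : IsChannel K) (hadm : ∀ y, 0 < push μ K y) : eta Φ μ K ≤ 1 := by
  refine Real.sSup_le ?_ zero_le_one
  rintro r ⟨ν, hν, -, rfl⟩
  exact fDiv_ratio_le_one hΦ hμ hK hadm hν

theorem fDiv_push_le_eta_mul (hΦ : ConvexOn ℝ (Set.Ici 0) Φ) (hμ : IsPosDist μ)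
    (hK : IsChannel K) (hadm : ∀ y, 0 < push μ K y) {ν : X → ℝ} (hν : IsDist ν) :
    fDiv Φ (push ν K) (push μ K) ≤ eta Φ μ K * fDiv Φ ν μ := by
  rcases (fDiv_nonneg hΦ hμ hν).eq_or_lt with h0 | hpos
  · rw [← h0, mul_zero, h0]
    exact fDiv_push_le hΦ hμ hK hadm hν
  · rw [← div_le_iff₀ hpos]
    refine le_csSup ⟨1, ?_⟩ ⟨ν, hν, ?_, rfl⟩
    · rintro r ⟨ν', hν', -, rfl⟩
      exact fDiv_ratio_le_one hΦ hμ hK hadm hν'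
    · rintro rfl
      have h1 : ∀ x, ν x / ν x = 1 := fun x => div_self (hμ.1 x).ne'
      simp [fDiv, h1, ← Finset.sum_mul, hν.2] at hpos

/-- The strong data processing inequality, extended by homogeneity to unnormalized densities. -/
theorem Ent_condExp_le_eta_mul (hΦ : ConvexOn ℝ (Set.Ici 0) Φ) (hhom : Homogeneous Φ)
    (hμ : IsPosDist μ) (hK : IsChannel K) (hadm : ∀ y, 0 < push μ K y)
    {f : X → ℝ} (hf : ∀ x, 0 ≤ f x) (hc : 0 < ∑ x, μ x * f x) :
    Ent Φ (push μ K) (condExp μ K f) ≤ eta Φ μ K * Ent Φ μ f := by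
  obtain ⟨κ, hκ, hscale⟩ := hhom
  set c := ∑ x, μ x * f x with hcdef
  have hν : IsDist fun x => μ x * f x / c :=
    ⟨fun x => div_nonneg (mul_nonneg (hμ.1 x).le (hf x)) hc.le, by
      rw [← Finset.sum_div, ← hcdef, div_self hc.ne']⟩
  have hdens : (fun x => μ x * f x / c / μ x) = fun x => f x / c := by
    ext x
    have := (hμ.1 x).ne'
    field_simp
  have key := fDiv_push_le_eta_mul hΦ hμ hK hadm hν
  rw [fDiv_push_eq_Ent Φ hμ.1 hK hadm hν.2, fDiv_eq_Ent Φ hμ.1 hν.2, hdens] at key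
  have hf' : ∀ x, 0 ≤ f x / c := fun x => div_nonneg (hf x) hc.le
  have h1 := hscale c hc X μ hμ.isDist _ hf'
  have h2 := hscale c hc Y (push μ K) ⟨fun y => (hadm y).le, (sum_push hK).trans hμ.2⟩
    (condExp μ K fun x => f x / c) fun y => div_nonneg
      (Finset.sum_nonneg fun x _ =>
        mul_nonneg (mul_nonneg (hμ.1 x).le (hK.1 x y)) (hf' x)) (hadm y).le
  have e1 : (fun x => c * (f x / c)) = f := funext fun x => mul_div_cancel₀ _ hc.ne'
  have e2 : (fun y => c * condExp μ K (fun x => f x / c) y) = condExp μ K f := by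
    ext y
    simp only [condExp, ← mul_div_assoc, Finset.mul_sum]
    congr 1
    refine Finset.sum_congr rfl fun x _ => ?_
    field_simp
  rw [e1] at h1
  rw [e2] at h2
  rw [h1, h2, mul_left_comm]
  exact mul_le_mul_of_nonneg_left key (hκ c hc).le

end Eta

/-- Theorem (comparison of SDPI constants): for two admissible pairs `(μ,K)` and
`(μ̄,K̄)` on the same alphabets with `μ̄⊗K̄` absolutely continuous w.r.t. `μ⊗K`,
and a convex `Φ` with homogeneous `Φ`-entropy,
`η_Φ(μ,K) ≤ 1 − (a/A)(1 − η_Φ(μ̄,K̄))`, where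
`A = max_{(x,y): μ(x)K(y|x)>0} μ̄(x)K̄(y|x)/(μ(x)K(y|x))` and `a = min_x μ̄(x)/μ(x)`. -/
theorem statement10 {X Y : Type} [Fintype X] [Fintype Y] [Nonempty X] [Nonempty Y]
    (Φ : ℝ → ℝ) (hconv : ConvexOn ℝ (Set.Ici 0) Φ) (hhom : Homogeneous Φ)
    (μ μ' : X → ℝ) (K K' : X → Y → ℝ)
    (hμ : IsPosDist μ) (hK : IsChannel K) (hadm : ∀ y, 0 < push μ K y)
    (hμ' : IsPosDist μ') (hK' : IsChannel K') (hadm' : ∀ y, 0 < push μ' K' y)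
    (habs : ∀ x y, 0 < μ' x * K' x y → 0 < μ x * K x y) :
    eta Φ μ K ≤
      1 - ((⨅ x, μ' x / μ x) /
            sSup { r | ∃ x y, 0 < μ x * K x y ∧ r = μ' x * K' x y / (μ x * K x y) }) *
          (1 - eta Φ μ' K') := by
  set a := ⨅ x, μ' x / μ x with ha
  set S := { r | ∃ x y, 0 < μ x * K x y ∧ r = μ' x * K' x y / (μ x * K x y) } with hS
  set A := sSup S with hA
  have hSbdd : BddAbove S := by
    refine ((Set.finite_range fun p : X × Y =>
      μ' p.1 * K' p.1 p.2 / (μ p.1 * K p.1 p.2)).subset ?_).bddAbove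
    rintro r ⟨x, y, -, rfl⟩
    exact ⟨(x, y), rfl⟩
  have hw : ∀ x y, 0 ≤ μ x * K x y := fun x y => mul_nonneg (hμ.1 x).le (hK.1 x y)
  have hw' : ∀ x y, 0 ≤ μ' x * K' x y := fun x y => mul_nonneg (hμ'.1 x).le (hK'.1 x y)
  have hwA : ∀ x y, μ' x * K' x y ≤ A * (μ x * K x y) := by
    intro x y
    rcases (hw x y).eq_or_lt with h | h
    · rw [← h, mul_zero]
      exact not_lt.1 fun h' => (habs x y h').ne h
    · rw [← div_le_iff₀ h]
      exact le_csSup hSbdd ⟨x, y, h, rfl⟩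
  have ha_pos : 0 < a := by
    obtain ⟨x, hx⟩ := exists_eq_ciInf_of_finite (f := fun x => μ' x / μ x)
    rw [ha, ← hx]
    exact div_pos (hμ'.1 x) (hμ.1 x)
  have ha_le : ∀ x, a * μ x ≤ μ' x := fun x => by
    rw [← le_div_iff₀ (hμ.1 x)]
    exact ciInf_le (Set.finite_range _).bddBelow x
  have hA_one : 1 ≤ A := by
    have h := Finset.sum_le_sum fun y (_ : y ∈ Finset.univ) =>
      Finset.sum_le_sum fun x (_ : x ∈ Finset.univ) => hwA x y
    simp only [← Finset.mul_sum] at h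
    change ∑ y, push μ' K' y ≤ A * ∑ y, push μ K y at h
    rwa [sum_push hK, sum_push hK', hμ.2, hμ'.2, mul_one] at h
  have hA_pos : 0 < A := one_pos.trans_le hA_one
  have ha_one : a ≤ 1 := by
    have h := Finset.sum_le_sum fun x (_ : x ∈ Finset.univ) => ha_le x
    rwa [← Finset.mul_sum, hμ.2, hμ'.2, mul_one] at h
  have hη_nonneg := eta_nonneg hconv hμ' hK' hadm'
  have hη_le := eta_le_one hconv hμ' hK' hadm'
  have hbound : 0 ≤ 1 - a / A * (1 - eta Φ μ' K') := by
    have : a / A ≤ 1 := div_le_one_of_le₀ (ha_one.trans hA_one) hA_pos.le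
    nlinarith [div_nonneg ha_pos.le hA_pos.le]
  refine Real.sSup_le ?_ hbound
  rintro r ⟨ν, hν, -, rfl⟩
  refine div_le_of_le_mul₀ (fDiv_nonneg hconv hμ hν) hbound ?_
  rw [fDiv_push_eq_Ent Φ hμ.1 hK hadm hν.2, fDiv_eq_Ent Φ hμ.1 hν.2]
  set f : X → ℝ := fun x => ν x / μ x with hf_def
  have hf : ∀ x, 0 ≤ f x := fun x => div_nonneg (hν.1 x) (hμ.1 x).le
  have hmean : ∑ x, μ x * f x = 1 := by
    rw [← hν.2]
    exact Finset.sum_congr rfl fun x _ => mul_div_cancel₀ _ (hμ.1 x).ne'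
  have hmean' : 0 < ∑ x, μ' x * f x := by
    have h := Finset.sum_le_sum fun x (_ : x ∈ Finset.univ) =>
      mul_le_mul_of_nonneg_right (ha_le x) (hf x)
    simp only [mul_assoc, ← Finset.mul_sum, hmean, mul_one] at h
    exact ha_pos.trans_le h
  have hdeficit : Ent Φ μ' f - Ent Φ (push μ' K') (condExp μ' K' f) ≤
      A * (Ent Φ μ f - Ent Φ (push μ K) (condExp μ K f)) := by
    rw [← sum_jensenGap_eq_Ent_sub_Ent Φ hK hadm, ← sum_jensenGap_eq_Ent_sub_Ent Φ hK' hadm',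
      Finset.mul_sum]
    exact Finset.sum_le_sum fun y _ => jensenGap_le_mul hconv (fun x => hw x y)
      (fun x => hw' x y) hf (hadm y) fun x => hwA x y
  have hsdpi := Ent_condExp_le_eta_mul hconv hhom hμ' hK' hadm' hf hmean'
  have hEnt : a * Ent Φ μ f ≤ Ent Φ μ' f := by
    have h := jensenGap_le_mul hconv (w := μ') (w' := μ) (A := a⁻¹) (fun x => (hμ'.1 x).le)
      (fun x => (hμ.1 x).le) hf (by simp [hμ'.2])
      fun x => (le_inv_mul_iff₀ ha_pos).2 (ha_le x)
    rwa [jensenGap_eq_Ent Φ hμ.2, jensenGap_eq_Ent Φ hμ'.2, le_inv_mul_iff₀ ha_pos] at h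
  have hlow : a * (1 - eta Φ μ' K') * Ent Φ μ f ≤
      A * (Ent Φ μ f - Ent Φ (push μ K) (condExp μ K f)) := by
    have := mul_le_mul_of_nonneg_left hEnt (sub_nonneg.2 hη_le)
    linarith
  have hdiv : a / A * (1 - eta Φ μ' K') * Ent Φ μ f ≤
      Ent Φ μ f - Ent Φ (push μ K) (condExp μ K f) := by
    rw [div_mul_eq_mul_div, div_mul_eq_mul_div, div_le_iff₀ hA_pos]
    linarith
  linarith

end SDPI
end
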